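/- Every 4-regular simple graph whose girth equals 4 (that is, it contains a cycle of length 4 and contains no cycle of length 3) admits a strong edge-coloring using at most 22 colors. -/

import Mathlib

/-- Two edges of `G` conflict in a strong edge-coloring: they share an endpoint,
or some endpoint of one is adjacent in `G` to some endpoint of the other. -/
def StrongConflict {V : Type*} (G : SimpleGraph V) (e f : Sym2 V) : Prop :=
  (∃ v, v ∈ e ∧ v ∈ f) ∨ (∃ u v, u ∈ e ∧ v ∈ f ∧ G.Adj u v)

/-- A strong edge-coloring of `G` with `k` colors: conflicting distinct edges
receive different colors. -/
def IsStrongEdgeColoring {V : Type*} (G : SimpleGraph V) {k : ℕ}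
    (C : G.edgeSet → Fin k) : Prop :=
  ∀ e f : G.edgeSet, e ≠ f → StrongConflict G (e : Sym2 V) (f : Sym2 V) → C e ≠ C f

open Finset

/-! ### List colorings of finite sets with respect to a conflict relation -/

section ListColoring

variable {α κ : Type*}

/-- `ψ` colors `E` from the lists `L`, giving different colors to `R`-related elements. -/
def IsListColoring (R : α → α → Prop) (E : Finset α) (L : α → Finset κ) (ψ : α → κ) : Prop :=
  (∀ e ∈ E, ψ e ∈ L e) ∧ ∀ e ∈ E, ∀ f ∈ E, e ≠ f → R e f → ψ e ≠ ψ f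

open Classical in
/-- Greedy coloring in the order of decreasing rank `ρ`. -/
theorem exists_isListColoring_of_rank [Nonempty κ] {R : α → α → Prop}
    (hR : ∀ e f, R e f → R f e) (ρ : α → ℕ) (L : α → Finset κ) (E : Finset α)
    (h : ∀ e ∈ E, ∃ B : Finset α, (∀ f ∈ E, f ≠ e → R e f → ρ e ≤ ρ f → f ∈ B) ∧ #B < #(L e)) :
    ∃ ψ, IsListColoring R E L ψ := by
  induction hn : #E generalizing E with
  | zero =>
    obtain rfl := card_eq_zero.mp hn
    exact ⟨fun _ => Classical.arbitrary κ, by simp [IsListColoring]⟩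
  | succ n ih =>
    obtain ⟨e, he, hmin⟩ := exists_min_image E ρ (card_pos.mp (by omega))
    obtain ⟨ψ, hψL, hψ⟩ := ih (E.erase e)
      (fun f hf => by
        obtain ⟨B, hB, hBL⟩ := h f (mem_of_mem_erase hf)
        exact ⟨B, fun g hg => hB g (mem_of_mem_erase hg), hBL⟩)
      (by rw [card_erase_of_mem he, hn]; rfl)
    obtain ⟨B, hB, hBL⟩ := h e he
    obtain ⟨c, hcL, hc⟩ := exists_mem_notMem_of_card_lt_card
      (lt_of_le_of_lt (card_image_le (f := ψ)) hBL)
    have hc' : ∀ f ∈ E, f ≠ e → R e f → c ≠ ψ f := by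
      rintro f hf hne hef rfl
      exact hc (mem_image_of_mem ψ (hB f hf hne hef (hmin f hf)))
    refine ⟨Function.update ψ e c, fun f hf => ?_, fun f hf g hg hfg hRfg => ?_⟩
    · by_cases hfe : f = e
      · subst hfe; simpa using hcL
      · simpa [hfe] using hψL f (by simp [hf, hfe])
    · by_cases hfe : f = e
      · subst hfe
        simpa [Ne.symm hfg] using hc' g hg (Ne.symm hfg) hRfg
      · by_cases hge : g = e
        · subst hge
          simpa [hfg] using (hc' f hf hfg (hR _ _ hRfg)).symm
        · simpa [hfe, hge] using hψ f (by simp [hf, hfe]) g (by simp [hg, hge]) hfg hRfg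

open Classical in
/-- Hall's theorem for lists indexed by a finset. -/
theorem exists_injOn_of_hall [Nonempty κ] (F : Finset α) (M : α → Finset κ)
    (h : ∀ S ⊆ F, #S ≤ #(S.biUnion M)) :
    ∃ ψ : α → κ, (∀ e ∈ F, ψ e ∈ M e) ∧ Set.InjOn ψ F := by
  obtain ⟨g, hinj, hg⟩ :=
    (all_card_le_biUnion_card_iff_exists_injective fun e : F => M e).mp fun S => by
      have := h (S.map (Function.Embedding.subtype _)) (by intro x; simp; tauto)
      rwa [card_map, map_eq_image, image_biUnion] at this
  refine ⟨fun e => if he : e ∈ F then g ⟨e, he⟩ else Classical.arbitrary κ, ?_, ?_⟩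
  · intro e he
    simpa [he] using hg ⟨e, he⟩
  · intro e he f hf hef
    rw [mem_coe] at he hf
    simpa [he, hf] using @hinj ⟨e, he⟩ ⟨f, hf⟩ (by simpa [he, hf] using hef)

open Classical in
/-- A system of distinct representatives for twelve large lists. -/
theorem exists_isListColoring_of_card_le [Nonempty κ] {R : α → α → Prop} {L : α → Finset κ}
    {E C : Finset α} (hE : #E = 12) (hCE : C ⊆ E) (hC : #C = 4)
    (hL : ∀ e ∈ E, 9 ≤ #(L e)) (hLC : ∀ e ∈ C, 11 ≤ #(L e))
    {c : α} (hcC : c ∈ C) (hc : 12 ≤ #(L c)) :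
    ∃ ψ, IsListColoring R E L ψ := by
  obtain ⟨ψ, hψL, hψ⟩ := exists_injOn_of_hall E L fun S hS => by
    have key : ∀ e ∈ S, #(L e) ≤ #(S.biUnion L) :=
      fun e he => card_le_card (subset_biUnion_of_mem L he)
    have hSE := card_le_card hS
    by_cases hSC : ∃ e ∈ S, e ∈ C
    · obtain ⟨e, heS, heC⟩ := hSC
      by_cases hcS : c ∈ S
      · have := key c hcS
        omega
      · have h1 := key e heS
        have h2 := hLC e heC
        have h3 : #S < #E := card_lt_card ⟨hS, fun h => hcS (h (hCE hcC))⟩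
        omega
    · have h1 : S ⊆ E \ C := fun e he => by
        rw [mem_sdiff]; exact ⟨hS he, fun heC => hSC ⟨e, he, heC⟩⟩
      have h2 := card_le_card h1
      rw [card_sdiff_of_subset hCE] at h2
      rcases S.eq_empty_or_nonempty with rfl | ⟨e, he⟩
      · simp
      · have h3 := key e he
        have h4 := hL e (hS he)
        omega
  exact ⟨ψ, hψL, fun e he f hf hef _ h => hef (hψ he hf h)⟩

open Classical in
/-- If two non-conflicting elements receive the common color `z`, a coloring of the others that
avoids `z` extends. -/
theorem IsListColoring.extend_pair {R : α → α → Prop} (hR : ∀ e f, R e f → R f e)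
    {L : α → Finset κ} {E : Finset α} {p q : α} {z : κ}
    (hp : z ∈ L p) (hq : z ∈ L q) (hpq : ¬ R p q) {ψ : α → κ}
    (hψ : IsListColoring R ((E.erase p).erase q) (fun e => (L e).erase z) ψ) :
    IsListColoring R E L (fun e => if e = p ∨ e = q then z else ψ e) := by
  obtain ⟨hψL, hψR⟩ := hψ
  have hpq' : ¬ R q p := fun h => hpq (hR _ _ h)
  have hz : ∀ e ∈ E, ¬ (e = p ∨ e = q) → ψ e ≠ z := fun e he hne =>
    (mem_erase.mp (hψL e (by simp; tauto))).1
  refine ⟨fun e he => ?_, fun e he f hf hef hRef => ?_⟩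
  · dsimp only
    split_ifs with h
    · rcases h with rfl | rfl <;> assumption
    · exact (mem_erase.mp (hψL e (by simp; tauto))).2
  · dsimp only
    split_ifs with h1 h2 h2
    · rcases h1 with rfl | rfl <;> rcases h2 with rfl | rfl <;> first | exact absurd rfl hef | tauto
    · exact (hz f hf h2).symm
    · exact hz e he h1
    · exact hψR e (by simp; tauto) f (by simp; tauto) hef hRef

open Classical in
/-- List coloring of twelve elements, four of which have long lists, when two of the others do
not conflict. -/
theorem exists_isListColoring_of_not_conflict {R : α → α → Prop} (hR : ∀ e f, R e f → R f e)
    {L : α → Finset κ} {E C : Finset α} {z : κ} (hE : #E = 12) (hCE : C ⊆ E) (hC : #C = 4)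
    (hz : ∀ e, z ∈ L e) (hL : ∀ e ∈ E, 7 ≤ #(L e)) (hLC : ∀ e ∈ C, 10 ≤ #(L e))
    (hCR : ∀ c ∈ C, ∀ e ∈ E, R c e)
    {p q : α} (hp : p ∈ E) (hq : q ∈ E) (hpq : p ≠ q) (hRpq : ¬ R p q)
    (h : (∃ p' ∈ (E.erase p).erase q, ∃ q' ∈ (E.erase p).erase q, p' ≠ q' ∧ ¬ R p' q') ∨
      ∃ c ∈ C, 11 ≤ #(L c)) :
    ∃ ψ, IsListColoring R E L ψ := by
  have : Nonempty κ := ⟨z⟩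
  have hnC : ∀ e ∈ E, ∀ f ∈ E, ¬ R e f → e ∉ C ∧ f ∉ C := fun e he f hf hef =>
    ⟨fun h => hef (hCR e h f hf), fun h => hef (hR _ _ (hCR f h e he))⟩
  set F := (E.erase p).erase q with hF
  set M : α → Finset κ := fun e => (L e).erase z with hM
  have hFE : F ⊆ E := fun e he => mem_of_mem_erase (mem_of_mem_erase he)
  have hCF : C ⊆ F := fun c hc => by
    have := hnC p hp q hq hRpq
    simp only [hF, mem_erase]
    exact ⟨by rintro rfl; tauto, by rintro rfl; tauto, hCE hc⟩
  have hFcard : #F = 10 := by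
    rw [hF, card_erase_of_mem (by simp [hq, hpq.symm]), card_erase_of_mem hp, hE]
  have hMcard : ∀ e, #(M e) = #(L e) - 1 := fun e => card_erase_of_mem (hz e)
  suffices ∃ ψ, IsListColoring R F M ψ by
    obtain ⟨ψ, hψ⟩ := this
    exact ⟨_, hψ.extend_pair hR (hz p) (hz q) hRpq⟩
  by_cases hcommon : ∃ p' ∈ F, ∃ q' ∈ F, p' ≠ q' ∧ ¬ R p' q' ∧ ∃ y, y ∈ M p' ∧ y ∈ M q'
  · obtain ⟨p', hp', q', hq', hne, hnR, y, hyp, hyq⟩ := hcommon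
    set F' := (F.erase p').erase q' with hF'
    have hF'F : F' ⊆ F := fun e he => mem_of_mem_erase (mem_of_mem_erase he)
    have hF'card : #F' = 8 := by
      rw [hF', card_erase_of_mem (by simp [hq', hne.symm]), card_erase_of_mem hp', hFcard]
    have hCF' : C ⊆ F' := fun c hc => by
      have := hnC p' (hFE hp') q' (hFE hq') hnR
      simp only [hF', mem_erase]
      exact ⟨by rintro rfl; tauto, by rintro rfl; tauto, hCF hc⟩
    have hM' : ∀ e, #(M e) - 1 ≤ #((M e).erase y) := fun e => pred_card_le_card_erase
    obtain ⟨ψ, hψL, hψ⟩ := exists_injOn_of_hall F' (fun e => (M e).erase y) fun S hS => by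
      have key : ∀ e ∈ S, #((M e).erase y) ≤ #(S.biUnion fun e => (M e).erase y) :=
        fun e he => card_le_card (subset_biUnion_of_mem (fun e => (M e).erase y) he)
      have hSF := card_le_card hS
      by_cases hSC : ∃ e ∈ S, e ∈ C
      · obtain ⟨e, heS, heC⟩ := hSC
        have h1 := key e heS
        have h2 := hM' e
        have h3 := hLC e heC
        have h4 := hMcard e
        omega
      · have h1 : S ⊆ F' \ C := fun e he => by
          rw [mem_sdiff]; exact ⟨hS he, fun heC => hSC ⟨e, he, heC⟩⟩
        have h2 := card_le_card h1
        rw [card_sdiff_of_subset hCF'] at h2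
        rcases S.eq_empty_or_nonempty with rfl | ⟨e, he⟩
        · simp
        · have h3 := key e he
          have h4 := hL e (hFE (hF'F (hS he)))
          have h5 := hM' e
          have h6 := hMcard e
          omega
    exact ⟨_, IsListColoring.extend_pair hR hyp hyq hnR
      ⟨hψL, fun e he f hf hef _ h => hef (hψ he hf h)⟩⟩
  · obtain ⟨ψ, hψL, hψ⟩ := exists_injOn_of_hall F M fun S hS => by
      have key : ∀ e ∈ S, #(M e) ≤ #(S.biUnion M) :=
        fun e he => card_le_card (subset_biUnion_of_mem M he)
      have hSF := card_le_card hS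
      by_cases hnon : ∃ p' ∈ S, ∃ q' ∈ S, p' ≠ q' ∧ ¬ R p' q'
      · obtain ⟨p', hp', q', hq', hne, hnR⟩ := hnon
        have hdisj : Disjoint (M p') (M q') := disjoint_left.mpr fun y hy hy' =>
          hcommon ⟨p', hS hp', q', hS hq', hne, hnR, y, hy, hy'⟩
        have h1 : #(M p' ∪ M q') ≤ #(S.biUnion M) := card_le_card
          (union_subset (subset_biUnion_of_mem M hp') (subset_biUnion_of_mem M hq'))
        rw [card_union_of_disjoint hdisj] at h1
        have h2 := hL p' (hFE (hS hp'))
        have h3 := hL q' (hFE (hS hq'))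
        have h4 := hMcard p'
        have h5 := hMcard q'
        omega
      · by_cases hSC : ∃ e ∈ S, e ∈ C
        · obtain ⟨e, heS, heC⟩ := hSC
          have h1 := key e heS
          have h2 := hLC e heC
          have h3 := hMcard e
          by_cases hSF' : S = F
          · subst hSF'
            rcases h with ⟨p', hp', q', hq', h⟩ | ⟨c, hc, hLc⟩
            · exact absurd ⟨p', hp', q', hq', h⟩ hnon
            · have h4 := key c (hCF hc)
              have h5 := hMcard c
              omega
          · have := card_lt_card (Finset.ssubset_iff_subset_ne.mpr ⟨hS, hSF'⟩)
            omega
        · have h1 : S ⊆ F \ C := fun e he => by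
            rw [mem_sdiff]; exact ⟨hS he, fun heC => hSC ⟨e, he, heC⟩⟩
          have h2 := card_le_card h1
          rw [card_sdiff_of_subset hCF] at h2
          rcases S.eq_empty_or_nonempty with rfl | ⟨e, he⟩
          · simp
          · have h3 := key e he
            have h4 := hL e (hFE (hS he))
            have h5 := hMcard e
            omega
    exact ⟨ψ, hψL, fun e he f hf hef _ h => hef (hψ he hf h)⟩

end ListColoring

/-! ### Conflicting edges -/

section Conflict

variable {V : Type*} {G : SimpleGraph V}

theorem StrongConflict.symm {e f : Sym2 V} (h : StrongConflict G e f) : StrongConflict G f e := by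
  rcases h with ⟨v, h1, h2⟩ | ⟨u, v, h1, h2, h3⟩
  · exact .inl ⟨v, h2, h1⟩
  · exact .inr ⟨v, u, h2, h1, h3.symm⟩

theorem strongConflict_mk_iff {u v : V} (huv : G.Adj u v) {f : Sym2 V} :
    StrongConflict G s(u, v) f ↔ ∃ x ∈ f, G.Adj u x ∨ G.Adj v x := by
  constructor
  · rintro (⟨x, h1, h2⟩ | ⟨x, y, h1, h2, h3⟩)
    · rcases Sym2.mem_iff.mp h1 with rfl | rfl
      · exact ⟨_, h2, .inr huv.symm⟩
      · exact ⟨_, h2, .inl huv⟩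
    · rcases Sym2.mem_iff.mp h1 with rfl | rfl
      · exact ⟨_, h2, .inl h3⟩
      · exact ⟨_, h2, .inr h3⟩
  · rintro ⟨x, hx, h | h⟩
    · exact .inr ⟨u, x, by simp, hx, h⟩
    · exact .inr ⟨v, x, by simp, hx, h⟩

theorem StrongConflict.of_mem {u x : V} {e f : Sym2 V} (hu : u ∈ e) (hx : x ∈ f)
    (h : G.Adj u x) : StrongConflict G e f :=
  .inr ⟨u, x, hu, hx, h⟩

theorem SimpleGraph.Reachable.exists_adj_dist_lt {v x : V} (h : G.Reachable v x) (hne : x ≠ v) :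
    ∃ y, G.Adj x y ∧ G.dist v y < G.dist v x := by
  obtain ⟨p, hp⟩ := h.symm.exists_walk_length_eq_dist
  cases p with
  | nil => exact absurd rfl hne
  | cons hadj p =>
    refine ⟨_, hadj, ?_⟩
    rw [SimpleGraph.dist_comm (u := v) (v := x), ← hp, SimpleGraph.dist_comm]
    exact Nat.lt_succ_of_le (SimpleGraph.dist_le p)

variable (G) in
/-- The edges of the component of `v` have a strong coloring with 22 colors. -/
def ComponentColorable (v : V) : Prop :=
  ∃ φ : Sym2 V → Fin 22, ∀ e ∈ G.edgeSet, ∀ f ∈ G.edgeSet, e ≠ f →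
    (∀ x ∈ e, G.Reachable v x) → (∀ x ∈ f, G.Reachable v x) → StrongConflict G e f → φ e ≠ φ f

theorem ComponentColorable.of_reachable {u v : V} (h : ComponentColorable G u)
    (huv : G.Reachable u v) : ComponentColorable G v := by
  obtain ⟨φ, hφ⟩ := h
  exact ⟨φ, fun e he f hf hef hre hrf => hφ e he f hf hef (fun x hx => huv.trans (hre x hx))
    fun x hx => huv.trans (hrf x hx)⟩

variable [Fintype V] [DecidableRel G.Adj]

variable (G) in
open Classical in
/-- The edges of `G` that conflict with `e`; they include `e` itself if `e` is an edge. -/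
noncomputable def conflictEdges (e : Sym2 V) : Finset (Sym2 V) :=
  {f ∈ G.edgeFinset | StrongConflict G e f}

theorem mem_conflictEdges {e f : Sym2 V} :
    f ∈ conflictEdges G e ↔ f ∈ G.edgeSet ∧ StrongConflict G e f := by
  simp [conflictEdges]

variable [DecidableEq V]

theorem mem_incidenceFinset_iff {v : V} {e : Sym2 V} :
    e ∈ G.incidenceFinset v ↔ e ∈ G.edgeSet ∧ v ∈ e := by
  simp [SimpleGraph.incidenceSet]

theorem incidenceFinset_subset_conflictEdges {u x : V} {e : Sym2 V} (hu : u ∈ e)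
    (h : G.Adj u x) : G.incidenceFinset x ⊆ conflictEdges G e := fun f hf => by
  rw [mem_incidenceFinset_iff] at hf
  exact mem_conflictEdges.mpr ⟨hf.1, .of_mem hu hf.2 h⟩

theorem card_incidenceFinset_of_regular (hreg : ∀ v, G.degree v = 4) (v : V) :
    #(G.incidenceFinset v) = 4 := by
  rw [G.card_incidenceFinset_eq_degree, hreg]

theorem card_incidenceFinset_union_of_adj (hreg : ∀ v, G.degree v = 4) {u v : V}
    (huv : G.Adj u v) : #(G.incidenceFinset u ∪ G.incidenceFinset v) = 7 := by
  have h : G.incidenceFinset u ∩ G.incidenceFinset v = {s(u, v)} := by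
    ext f
    simp only [mem_inter, mem_incidenceFinset_iff, mem_singleton]
    constructor
    · rintro ⟨⟨_, h1⟩, _, h2⟩
      exact (Sym2.mem_and_mem_iff huv.ne).mp ⟨h1, h2⟩
    · rintro rfl
      simpa using huv
  have := card_union_add_card_inter (G.incidenceFinset u) (G.incidenceFinset v)
  rw [h, card_singleton, card_incidenceFinset_of_regular hreg,
    card_incidenceFinset_of_regular hreg] at this
  omega

/-- An edge `uv` of a 4-regular graph has at most 24 conflicts, and every 4-cycle through `uv`
saves one. -/
theorem card_conflictEdges_add_card_le (hreg : ∀ v, G.degree v = 4) {u v : V}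
    (huv : G.Adj u v) (X : Finset (Sym2 V))
    (hX : ∀ f ∈ X, u ∉ f ∧ v ∉ f ∧ ∃ x y, f = s(x, y) ∧ G.Adj x y ∧ G.Adj u x ∧ G.Adj v y) :
    #(conflictEdges G s(u, v)) + #X ≤ 25 := by
  set I : V → Finset (Sym2 V) := fun w =>
    (G.neighborFinset w).biUnion fun x => G.incidenceFinset x with hI
  have hIcard : ∀ w, #(I w) ≤ 16 := fun w => by
    have := card_biUnion_le_card_mul (G.neighborFinset w) (fun x => G.incidenceFinset x) 4
      fun x _ => (card_incidenceFinset_of_regular hreg x).le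
    rwa [G.card_neighborFinset_eq_degree, hreg] at this
  have hmemI : ∀ w f, f ∈ I w ↔ ∃ x, G.Adj w x ∧ f ∈ G.edgeSet ∧ x ∈ f := fun w f => by
    simp [hI, SimpleGraph.incidenceSet]
  have hsub : conflictEdges G s(u, v) ⊆ I u ∪ I v := fun f hf => by
    obtain ⟨h1, h2⟩ := mem_conflictEdges.mp hf
    obtain ⟨x, hx, h | h⟩ := (strongConflict_mk_iff huv).mp h2
    · exact mem_union_left _ ((hmemI _ _).mpr ⟨x, h, h1, hx⟩)
    · exact mem_union_right _ ((hmemI _ _).mpr ⟨x, h, h1, hx⟩)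
  have hinc : ∀ w, G.incidenceFinset w ⊆ I w := fun w f hf => by
    obtain ⟨h1, h2⟩ := mem_incidenceFinset_iff.mp hf
    obtain ⟨x, rfl⟩ := h2
    exact (hmemI _ _).mpr ⟨x, h1, h1, by simp⟩
  have hinc' : ∀ {w x}, G.Adj w x → G.incidenceFinset x ⊆ I w := fun h f hf => by
    obtain ⟨h1, h2⟩ := mem_incidenceFinset_iff.mp hf
    exact (hmemI _ _).mpr ⟨_, h, h1, h2⟩
  have hsup : (G.incidenceFinset u ∪ G.incidenceFinset v) ∪ X ⊆ I u ∩ I v := by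
    refine union_subset (union_subset ?_ ?_) fun f hf => ?_
    · exact subset_inter (hinc u) (hinc' huv.symm)
    · exact subset_inter (hinc' huv) (hinc v)
    · obtain ⟨-, -, x, y, rfl, hxy, hux, hvy⟩ := hX f hf
      exact mem_inter.mpr ⟨(hmemI _ _).mpr ⟨x, hux, hxy, by simp⟩,
        (hmemI _ _).mpr ⟨y, hvy, hxy, by simp⟩⟩
  have hdisj : Disjoint (G.incidenceFinset u ∪ G.incidenceFinset v) X :=
    disjoint_right.mpr fun f hf h => by
      have := hX f hf
      rw [mem_union, mem_incidenceFinset_iff, mem_incidenceFinset_iff] at h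
      tauto
  have h1 := card_le_card hsub
  have h2 := card_le_card hsup
  rw [card_union_of_disjoint hdisj, card_incidenceFinset_union_of_adj hreg huv] at h2
  have h3 := card_union_add_card_inter (I u) (I v)
  have h4 := hIcard u
  have h5 := hIcard v
  omega

theorem card_conflictEdges_le (hreg : ∀ v, G.degree v = 4) {e : Sym2 V} (he : e ∈ G.edgeSet) :
    #(conflictEdges G e) ≤ 25 := by
  induction e with
  | h u v => simpa using card_conflictEdges_add_card_le hreg he ∅ (by simp)

/-! ### Coloring one component -/

/-- The edges of a component that avoid a given vertex `v` can be colored with 21 of the 22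
colors. -/
theorem exists_coloring_off_vertex (hreg : ∀ v, G.degree v = 4) (v : V) :
    ∃ φ : Sym2 V → Fin 22, (∀ e, φ e ≠ Fin.last 21) ∧
      ∀ e ∈ G.edgeSet, ∀ f ∈ G.edgeSet, e ≠ f → v ∉ e → v ∉ f →
        (∀ x ∈ e, G.Reachable v x) → (∀ x ∈ f, G.Reachable v x) →
          StrongConflict G e f → φ e ≠ φ f := by
  classical
  set T : Finset (Sym2 V) := {e ∈ G.edgeFinset | v ∉ e ∧ ∀ x ∈ e, G.Reachable v x} with hT
  set ρ : Sym2 V → ℕ := Sym2.lift ⟨fun x y => min (G.dist v x) (G.dist v y),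
    fun _ _ => min_comm _ _⟩ with hρ
  have hρle : ∀ e x, x ∈ e → ρ e ≤ G.dist v x := by
    rintro e x ⟨y, rfl⟩
    simp [hρ]
  have key : ∀ x y, s(x, y) ∈ T → G.dist v x ≤ G.dist v y → ∃ B : Finset (Sym2 V),
      (∀ f ∈ T, f ≠ s(x, y) → StrongConflict G s(x, y) f → ρ s(x, y) ≤ ρ f → f ∈ B) ∧
        #B < #((univ : Finset (Fin 22)).erase (Fin.last 21)) := by
    intro x y he hle
    simp only [hT, mem_filter, SimpleGraph.mem_edgeFinset, SimpleGraph.mem_edgeSet, Sym2.mem_iff,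
      not_or] at he
    obtain ⟨hxy, ⟨hvx, -⟩, hr⟩ := he
    obtain ⟨z, hxz, hz⟩ := (hr x (.inl rfl)).exists_adj_dist_lt (Ne.symm hvx)
    refine ⟨(conflictEdges G s(x, y) \ G.incidenceFinset z).erase s(x, y), ?_, ?_⟩
    · intro f hf hne hcf hρf
      simp only [hT, mem_filter, SimpleGraph.mem_edgeFinset] at hf
      simp only [mem_erase, mem_sdiff, mem_conflictEdges, mem_incidenceFinset_iff]
      refine ⟨hne, ⟨hf.1, hcf⟩, fun h => ?_⟩
      have h1 := hρle f z h.2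
      have h2 : ρ s(x, y) = G.dist v x := by simp [hρ, hle]
      omega
    · have hmem : s(x, y) ∈ conflictEdges G s(x, y) \ G.incidenceFinset z := by
        simp only [mem_sdiff, mem_conflictEdges, mem_incidenceFinset_iff]
        refine ⟨⟨hxy, .inl ⟨x, by simp⟩⟩, fun h => ?_⟩
        rcases Sym2.mem_iff.mp h.2 with rfl | rfl <;> omega
      rw [card_erase_of_mem hmem, card_sdiff_of_subset
        (incidenceFinset_subset_conflictEdges (Sym2.mem_mk_left x y) hxz),
        card_incidenceFinset_of_regular hreg, card_erase_of_mem (mem_univ _), card_fin]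
      have h2 := card_conflictEdges_le hreg (G.mem_edgeSet.mpr hxy)
      omega
  obtain ⟨φ, hφL, hφ⟩ := exists_isListColoring_of_rank (R := StrongConflict G)
    (fun _ _ => StrongConflict.symm) ρ
    (fun _ => (univ : Finset (Fin 22)).erase (Fin.last 21)) T fun e he => by
      induction e with
      | h x y =>
        rcases le_total (G.dist v x) (G.dist v y) with hle | hle
        · exact key x y he hle
        · rw [Sym2.eq_swap] at he ⊢
          exact key y x he hle
  refine ⟨fun e => if e ∈ T then φ e else 0, fun e => ?_, ?_⟩
  · dsimp only
    split_ifs with h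
    · exact (mem_erase.mp (hφL e h)).1
    · decide
  · intro e he f hf hef hve hvf hre hrf hc
    have heT : e ∈ T := by simp [hT, he, hve]; exact hre
    have hfT : f ∈ T := by simp [hT, hf, hvf]; exact hrf
    simpa [heT, hfT] using hφ e heT f hfT hef hc

/-- It suffices to color a set `E` of edges containing all edges at a vertex from lists all of
which contain a common color. -/
theorem componentColorable_of_listColoring (hreg : ∀ v, G.degree v = 4) (v : V)
    (E : Finset (Sym2 V)) (hvE : G.incidenceFinset v ⊆ E)
    (h : ∀ L : Sym2 V → Finset (Fin 22), (∀ e, Fin.last 21 ∈ L e) →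
      (∀ e ∈ E, 22 + #(conflictEdges G e ∩ E) ≤ #(L e) + #(conflictEdges G e)) →
        ∃ ψ, IsListColoring (StrongConflict G) E L ψ) :
    ComponentColorable G v := by
  classical
  obtain ⟨φ, hφlast, hφ⟩ := exists_coloring_off_vertex hreg v
  obtain ⟨ψ, hψL, hψ⟩ := h (fun e => univ \ image φ (conflictEdges G e \ E))
    (fun e => by
      rw [mem_sdiff, mem_image]
      exact ⟨mem_univ _, fun ⟨f, _, hf⟩ => hφlast f hf⟩) (fun e he => by
      have h1 : #(image φ (conflictEdges G e \ E)) ≤ #(conflictEdges G e \ E) := card_image_le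
      have h2 := card_sdiff_add_card_inter (conflictEdges G e) E
      have h3 := card_sdiff_add_card_eq_card (subset_univ (image φ (conflictEdges G e \ E)))
      rw [card_fin] at h3
      omega)
  have hmix : ∀ e ∈ E, ∀ f ∈ G.edgeSet, f ∉ E → StrongConflict G e f → ψ e ≠ φ f := by
    intro e he f hf hfE hc heq
    have := hψL e he
    rw [mem_sdiff] at this
    exact this.2 (heq ▸ mem_image_of_mem φ (mem_sdiff.mpr ⟨mem_conflictEdges.mpr ⟨hf, hc⟩, hfE⟩))
  refine ⟨fun e => if e ∈ E then ψ e else φ e, fun e he f hf hef hre hrf hc => ?_⟩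
  have hnv : ∀ e ∈ G.edgeSet, e ∉ E → v ∉ e := fun e he heE hv =>
    heE (hvE (mem_incidenceFinset_iff.mpr ⟨he, hv⟩))
  dsimp only
  split_ifs with h1 h2 h2
  · exact hψ e h1 f h2 hef hc
  · exact hmix e h1 f hf h2 hc
  · exact (hmix f h2 e he h1 hc.symm).symm
  · exact hφ e he f hf hef (hnv e he h1) (hnv f hf h2) hre hrf hc

end Conflict

/-! ### Components without 4-cycles -/

section NoFourCycle

variable {V : Type*} {G : SimpleGraph V}

/-- Three pairs with at most a matching between any two of them and no triangle have an
independent transversal. -/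
theorem exists_independent_transversal_of_pairs {a a' b b' c c' : V}
    (htf : ∀ x y z, G.Adj x y → G.Adj y z → ¬ G.Adj x z)
    (hab : ∀ x ∈ ({a, a'} : Set V), ¬ (G.Adj x b ∧ G.Adj x b'))
    (hac : ∀ x ∈ ({a, a'} : Set V), ¬ (G.Adj x c ∧ G.Adj x c'))
    (hba : ∀ x ∈ ({b, b'} : Set V), ¬ (G.Adj a x ∧ G.Adj a' x))
    (hbc : ∀ x ∈ ({b, b'} : Set V), ¬ (G.Adj x c ∧ G.Adj x c'))
    (hca : ∀ x ∈ ({c, c'} : Set V), ¬ (G.Adj a x ∧ G.Adj a' x))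
    (hcb : ∀ x ∈ ({c, c'} : Set V), ¬ (G.Adj b x ∧ G.Adj b' x)) :
    ∃ x ∈ ({a, a'} : Set V), ∃ y ∈ ({b, b'} : Set V), ∃ z ∈ ({c, c'} : Set V),
      ¬ G.Adj x y ∧ ¬ G.Adj x z ∧ ¬ G.Adj y z := by
  simp only [Set.mem_insert_iff, Set.mem_singleton_iff, forall_eq_or_imp, forall_eq,
    exists_eq_or_imp, exists_eq_left] at *
  have h1 := htf a b c
  have h2 := htf a b c'
  have h3 := htf a b' c
  have h4 := htf a b' c'
  have h5 := htf a' b c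
  have h6 := htf a' b c'
  have h7 := htf a' b' c
  have h8 := htf a' b' c'
  clear htf
  grind

variable [Fintype V] [DecidableRel G.Adj] [DecidableEq V]

/-- Around a vertex `v` on no 4-cycle there are four pairwise non-adjacent vertices at distance two
hanging from the four different neighbors of `v`. -/
theorem exists_independent_transversal (hreg : ∀ v, G.degree v = 4)
    (htf : ∀ x y z, G.Adj x y → G.Adj y z → ¬ G.Adj x z) (v : V)
    (hnc4 : ∀ b d a c, G.Reachable v b → b ≠ d → G.Adj b a → G.Adj b c → G.Adj d a → G.Adj d c →
      a = c) :
    ∃ g : V → V, (∀ x, G.Adj v x → G.Adj x (g x) ∧ g x ≠ v) ∧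
      ∀ x y, G.Adj v x → G.Adj v y → ¬ G.Adj (g x) (g y) := by
  obtain ⟨x₁, x₂, x₃, x₄, h12, h13, h14, h23, h24, h34, hN⟩ := card_eq_four.mp
    ((G.card_neighborFinset_eq_degree v).trans (hreg v))
  have hv : ∀ x, G.Adj v x ↔ x = x₁ ∨ x = x₂ ∨ x = x₃ ∨ x = x₄ := fun x => by
    rw [← G.mem_neighborFinset, hN]; simp
  have hv1 := (hv x₁).mpr (by simp)
  have hv2 := (hv x₂).mpr (by simp)
  have hv3 := (hv x₃).mpr (by simp)
  have hv4 := (hv x₄).mpr (by simp)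
  have hmatch : ∀ {x y}, G.Adj v x → G.Adj v y → x ≠ y → ∀ {w}, G.Adj y w → w ≠ v →
      ∀ {u u'}, G.Adj x u → G.Adj x u' → u ≠ u' → ¬ (G.Adj w u ∧ G.Adj w u') := by
    rintro x y hx hy - w hyw - u u' hu hu' hne ⟨hwu, hwu'⟩
    refine hne (hnc4 x w u u' hx.reachable ?_ hu hu' hwu hwu')
    rintro rfl
    exact htf v y x hy hyw hx
  have hmatch' : ∀ {x y}, G.Adj v x → G.Adj v y → x ≠ y → ∀ {w}, G.Adj y w → w ≠ v →
      ∀ {u u'}, G.Adj x u → G.Adj x u' → u ≠ u' → ¬ (G.Adj u w ∧ G.Adj u' w) := by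
    intro x y hx hy hxy w hyw hw u u' hu hu' hne h
    exact hmatch hx hy hxy hyw hw hu hu' hne ⟨h.1.symm, h.2.symm⟩
  have hW : ∀ x, G.Adj v x → #((G.neighborFinset x).erase v) = 3 := fun x hx => by
    rw [card_erase_of_mem (by simpa using hx.symm), G.card_neighborFinset_eq_degree, hreg]
  obtain ⟨w, hw⟩ := card_pos.mp (by rw [hW x₁ hv1]; norm_num :
    0 < #((G.neighborFinset x₁).erase v))
  obtain ⟨hwv, hw⟩ : w ≠ v ∧ G.Adj x₁ w := by simpa using hw
  have hpair : ∀ {x}, G.Adj v x → x ≠ x₁ → ∃ u u', u ≠ u' ∧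
      (G.Adj x u ∧ u ≠ v ∧ ¬ G.Adj w u) ∧ (G.Adj x u' ∧ u' ≠ v ∧ ¬ G.Adj w u') := by
    intro x hx hxx
    have h1 := card_filter_add_card_filter_not (s := (G.neighborFinset x).erase v)
      (fun u => G.Adj w u)
    have h2 : #{u ∈ (G.neighborFinset x).erase v | G.Adj w u} ≤ 1 := card_le_one.mpr (by
      intro u hu u' hu'
      simp only [mem_filter, mem_erase, SimpleGraph.mem_neighborFinset] at hu hu'
      by_contra hne
      exact hmatch hx hv1 hxx hw hwv hu.1.2 hu'.1.2 hne ⟨hu.2, hu'.2⟩)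
    rw [hW x hx] at h1
    obtain ⟨u, hu, u', hu', hne⟩ := one_lt_card.mp
      (show 1 < #{u ∈ (G.neighborFinset x).erase v | ¬ G.Adj w u} by omega)
    simp only [mem_filter, mem_erase, SimpleGraph.mem_neighborFinset] at hu hu'
    exact ⟨u, u', hne, by tauto, by tauto⟩
  obtain ⟨a, a', haa, ha, ha'⟩ := hpair hv2 h12.symm
  obtain ⟨b, b', hbb, hb, hb'⟩ := hpair hv3 h13.symm
  obtain ⟨c, c', hcc, hc, hc'⟩ := hpair hv4 h14.symm
  have hA : ∀ x ∈ ({a, a'} : Set V), G.Adj x₂ x ∧ x ≠ v ∧ ¬ G.Adj w x := by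
    rintro x (rfl | rfl) <;> assumption
  have hB : ∀ x ∈ ({b, b'} : Set V), G.Adj x₃ x ∧ x ≠ v ∧ ¬ G.Adj w x := by
    rintro x (rfl | rfl) <;> assumption
  have hC : ∀ x ∈ ({c, c'} : Set V), G.Adj x₄ x ∧ x ≠ v ∧ ¬ G.Adj w x := by
    rintro x (rfl | rfl) <;> assumption
  obtain ⟨x, hx, y, hy, z, hz, hxy, hxz, hyz⟩ := exists_independent_transversal_of_pairs htf
    (fun x hx => hmatch hv3 hv2 h23.symm (hA x hx).1 (hA x hx).2.1 hb.1 hb'.1 hbb)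
    (fun x hx => hmatch hv4 hv2 h24.symm (hA x hx).1 (hA x hx).2.1 hc.1 hc'.1 hcc)
    (fun x hx => hmatch' hv2 hv3 h23 (hB x hx).1 (hB x hx).2.1 ha.1 ha'.1 haa)
    (fun x hx => hmatch hv4 hv3 h34.symm (hB x hx).1 (hB x hx).2.1 hc.1 hc'.1 hcc)
    (fun x hx => hmatch' hv2 hv4 h24 (hC x hx).1 (hC x hx).2.1 ha.1 ha'.1 haa)
    (fun x hx => hmatch' hv3 hv4 h34 (hC x hx).1 (hC x hx).2.1 hb.1 hb'.1 hbb)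
  have hx' := hA x hx
  have hy' := hB y hy
  have hz' := hC z hz
  refine ⟨fun u => if u = x₁ then w else if u = x₂ then x else if u = x₃ then y else z, ?_, ?_⟩
  · intro u hu
    rcases (hv u).mp hu with rfl | rfl | rfl | rfl <;> simp [*, Ne.symm]
  · intro u u' hu hu'
    rcases (hv u).mp hu with rfl | rfl | rfl | rfl <;>
      rcases (hv u').mp hu' with rfl | rfl | rfl | rfl <;>
        simp [*, Ne.symm, G.adj_comm]

theorem componentColorable_of_no_four_cycle (hreg : ∀ v, G.degree v = 4)
    (htf : ∀ x y z, G.Adj x y → G.Adj y z → ¬ G.Adj x z) (v : V)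
    (hnc4 : ∀ b d a c, G.Reachable v b → b ≠ d → G.Adj b a → G.Adj b c → G.Adj d a → G.Adj d c →
      a = c) :
    ComponentColorable G v := by
  classical
  obtain ⟨g, hg, hgg⟩ := exists_independent_transversal hreg htf v hnc4
  set E : Finset (Sym2 V) := {e ∈ G.edgeFinset | ∃ y ∈ e, G.Adj v y} with hE
  have hmemE : ∀ e, e ∈ E ↔ e ∈ G.edgeSet ∧ ∃ y ∈ e, G.Adj v y := fun e => by simp [hE]
  have hvE : G.incidenceFinset v ⊆ E := fun e he => by
    obtain ⟨he, x, rfl⟩ := mem_incidenceFinset_iff.mp he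
    exact (hmemE _).mpr ⟨he, x, by simp, he⟩
  refine componentColorable_of_listColoring hreg v E hvE fun L hlast hL => ?_
  set P := E \ G.incidenceFinset v with hP
  have hPE : P ⊆ E := sdiff_subset
  set I := (G.neighborFinset v).image fun x => s(x, g x) with hI
  have hIP : I ⊆ P := by
    intro e he
    obtain ⟨x, hx, rfl⟩ := mem_image.mp he
    rw [SimpleGraph.mem_neighborFinset] at hx
    rw [hP, mem_sdiff, hmemE, mem_incidenceFinset_iff]
    refine ⟨⟨(hg x hx).1, x, by simp, hx⟩, fun h => ?_⟩
    rcases Sym2.mem_iff.mp h.2 with h | h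
    · exact hx.ne h
    · exact (hg x hx).2 h.symm
  have hIcard : #I = 4 := by
    rw [hI, card_image_of_injOn, G.card_neighborFinset_eq_degree, hreg]
    intro x hx y hy hxy
    simp only [SimpleGraph.coe_neighborFinset, SimpleGraph.mem_neighborSet] at hx hy
    rcases Sym2.eq_iff.mp hxy with h | h
    · exact h.1
    · exact absurd hy (htf v x y hx (h.2 ▸ (hg x hx).1))
  have hIindep : ∀ e ∈ I, ∀ f ∈ I, e ≠ f → ¬ StrongConflict G e f := by
    intro e he f hf hef hc
    obtain ⟨x, hx, rfl⟩ := mem_image.mp he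
    obtain ⟨y, hy, rfl⟩ := mem_image.mp hf
    rw [SimpleGraph.mem_neighborFinset] at hx hy
    have hxy : x ≠ y := by rintro rfl; exact hef rfl
    obtain ⟨z, hz, hadj⟩ := (strongConflict_mk_iff (hg x hx).1).mp hc
    rcases Sym2.mem_iff.mp hz with rfl | rfl
    · rcases hadj with hadj | hadj
      · exact htf v x _ hx hadj hy
      · exact (hg x hx).2 (hnc4 x _ v (g x) hx.reachable hxy hx.symm (hg x hx).1 hy.symm
          hadj.symm).symm
    · rcases hadj with hadj | hadj
      · exact (hg y hy).2 (hnc4 x y v (g y) hx.reachable hxy hx.symm hadj hy.symm (hg y hy).1).symm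
      · exact hgg x y hx hy hadj
  have hincP : ∀ e ∈ P, G.incidenceFinset v ⊆ conflictEdges G e := fun e he => by
    obtain ⟨-, y, hy, hvy⟩ := (hmemE e).mp (hPE he)
    exact incidenceFinset_subset_conflictEdges hy hvy.symm
  obtain ⟨ψ₁, hψ₁L, hψ₁⟩ := exists_isListColoring_of_rank (R := StrongConflict G)
    (fun _ _ => StrongConflict.symm) (fun _ => 0) (fun e => (L e).erase (Fin.last 21)) (P \ I)
    fun e he => by
      obtain ⟨heP, heI⟩ := mem_sdiff.mp he
      have heG := ((hmemE e).mp (hPE heP)).1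
      refine ⟨{f ∈ P \ I | f ≠ e ∧ StrongConflict G e f}, fun f hf hne hc _ => by
        simp only [mem_filter]; exact ⟨hf, hne, hc⟩, ?_⟩
      set B : Finset (Sym2 V) := {f ∈ P \ I | f ≠ e ∧ StrongConflict G e f} with hB
      have heB : e ∉ B := by simp [hB]
      have hdisj : Disjoint (G.incidenceFinset v) (insert e B) := disjoint_right.mpr fun f hf => by
        have : f ∈ P := by
          rcases mem_insert.mp hf with rfl | hf
          · exact heP
          · exact (mem_sdiff.mp (mem_filter.mp hf).1).1
        exact (mem_sdiff.mp this).2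
      have hsub : G.incidenceFinset v ∪ insert e B ⊆ conflictEdges G e ∩ E := by
        refine union_subset (subset_inter (hincP e heP) hvE) (insert_subset ?_ fun f hf => ?_)
        · refine mem_inter.mpr ⟨mem_conflictEdges.mpr ⟨heG, ?_⟩, hPE heP⟩
          obtain ⟨x, hx, -⟩ := ((hmemE e).mp (hPE heP)).2
          exact .inl ⟨x, hx, hx⟩
        · obtain ⟨hfP, -, hc⟩ := mem_filter.mp hf
          have hfE := hPE (mem_sdiff.mp hfP).1
          exact mem_inter.mpr ⟨mem_conflictEdges.mpr ⟨((hmemE f).mp hfE).1, hc⟩, hfE⟩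
      have h1 := card_le_card hsub
      rw [card_union_of_disjoint hdisj, card_insert_of_notMem heB,
        card_incidenceFinset_of_regular hreg] at h1
      have h2 := card_conflictEdges_le hreg heG
      have h3 := hL e (hPE heP)
      rw [card_erase_of_mem (hlast e)]
      omega
  have hψ₁last : ∀ e ∈ P \ I, ψ₁ e ≠ Fin.last 21 := fun e he => (mem_erase.mp (hψ₁L e he)).1
  set ψ₂ : Sym2 V → Fin 22 := fun e => if e ∈ I then Fin.last 21 else ψ₁ e with hψ₂
  have hψ₂P : #(P.image ψ₂) ≤ 1 + #(P \ I) := by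
    have : P.image ψ₂ ⊆ insert (Fin.last 21) ((P \ I).image ψ₁) := fun y hy => by
      obtain ⟨e, he, rfl⟩ := mem_image.mp hy
      by_cases heI : e ∈ I
      · simp [hψ₂, heI]
      · simp only [hψ₂, heI, if_false]
        exact mem_insert_of_mem (mem_image_of_mem _ (mem_sdiff.mpr ⟨he, heI⟩))
    have h1 := card_le_card this
    have h2 := card_insert_le (Fin.last 21) ((P \ I).image ψ₁)
    have h3 : #((P \ I).image ψ₁) ≤ #(P \ I) := card_image_le
    omega
  rw [card_sdiff_of_subset hIP, hIcard] at hψ₂P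
  have hPcard : #P = #E - 4 := by
    rw [hP, card_sdiff_of_subset hvE, card_incidenceFinset_of_regular hreg]
  have hIle := card_le_card hIP
  obtain ⟨ψ₃, hψ₃L, hψ₃⟩ := exists_isListColoring_of_rank (R := StrongConflict G)
    (fun _ _ => StrongConflict.symm) (fun _ => 0) (fun e => L e \ P.image ψ₂)
    (G.incidenceFinset v) fun e he => by
      refine ⟨(G.incidenceFinset v).erase e, fun f hf hne _ _ => mem_erase.mpr ⟨hne, hf⟩, ?_⟩
      obtain ⟨heG, hve⟩ := mem_incidenceFinset_iff.mp he
      have hsub : E ⊆ conflictEdges G e := fun f hf => by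
        obtain ⟨hfG, y, hy, hvy⟩ := (hmemE f).mp hf
        exact mem_conflictEdges.mpr ⟨hfG, .of_mem hve hy hvy⟩
      have h1 := hL e (hvE he)
      rw [inter_eq_right.mpr hsub] at h1
      have h2 := card_conflictEdges_le hreg heG
      have h3 := le_card_sdiff (P.image ψ₂) (L e)
      rw [card_erase_of_mem he, card_incidenceFinset_of_regular hreg]
      omega
  have hmix : ∀ e ∈ G.incidenceFinset v, ∀ f ∈ P, ψ₃ e ≠ ψ₂ f := fun e he f hf heq =>
    (mem_sdiff.mp (hψ₃L e he)).2 (heq ▸ mem_image_of_mem ψ₂ hf)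
  have hψ₂proper : ∀ e ∈ P, ∀ f ∈ P, e ≠ f → StrongConflict G e f → ψ₂ e ≠ ψ₂ f := by
    intro e he f hf hef hc
    simp only [hψ₂]
    split_ifs with h1 h2 h2
    · exact absurd hc (hIindep e h1 f h2 hef)
    · exact (hψ₁last f (mem_sdiff.mpr ⟨hf, h2⟩)).symm
    · exact hψ₁last e (mem_sdiff.mpr ⟨he, h1⟩)
    · exact hψ₁ e (mem_sdiff.mpr ⟨he, h1⟩) f (mem_sdiff.mpr ⟨hf, h2⟩) hef hc
  have hnotinc : ∀ e ∈ E, e ∉ G.incidenceFinset v → e ∈ P := fun e he h => mem_sdiff.mpr ⟨he, h⟩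
  refine ⟨fun e => if e ∈ G.incidenceFinset v then ψ₃ e else ψ₂ e, fun e he => ?_,
    fun e he f hf hef hc => ?_⟩
  · dsimp only
    split_ifs with h
    · exact (mem_sdiff.mp (hψ₃L e h)).1
    · simp only [hψ₂]
      split_ifs with hi
      · exact hlast e
      · exact (mem_erase.mp (hψ₁L e (mem_sdiff.mpr ⟨hnotinc e he h, hi⟩))).2
  · dsimp only
    split_ifs with h1 h2 h2
    · exact hψ₃ e h1 f h2 hef hc
    · exact hmix e h1 f (hnotinc f hf h2)
    · exact (hmix f h2 e (hnotinc e he h1)).symm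
    · exact hψ₂proper e (hnotinc e he h1) f (hnotinc f hf h2) hef hc

end NoFourCycle

/-! ### Components with a 4-cycle -/

section FourCycle

variable {V : Type*} {G : SimpleGraph V}

variable (G) in
/-- `a b c d` is a 4-cycle of `G`. -/
structure IsFourCycle (a b c d : V) : Prop where
  ab : G.Adj a b
  bc : G.Adj b c
  cd : G.Adj c d
  da : G.Adj d a
  ac : a ≠ c
  bd : b ≠ d

theorem IsFourCycle.rotate {a b c d : V} (h : IsFourCycle G a b c d) : IsFourCycle G b c d a :=
  ⟨h.bc, h.cd, h.da, h.ab, h.bd, h.ac.symm⟩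

/-- Edges hanging from opposite vertices of a 4-cycle whose outer endpoints are different conflict
only if these endpoints are adjacent. -/
theorem IsFourCycle.adj_of_conflict (htf : ∀ x y z, G.Adj x y → G.Adj y z → ¬ G.Adj x z)
    {a b c d : V} (h : IsFourCycle G a b c d)
    (hcommon : ∀ w, G.Adj a w → G.Adj w c → w = b ∨ w = d) {w u : V}
    (haw : G.Adj a w) (hw : w ≠ b ∧ w ≠ d) (hcu : G.Adj c u) (hu : u ≠ b ∧ u ≠ d)
    (hc : StrongConflict G s(a, w) s(c, u)) : G.Adj w u := by
  obtain ⟨z, hz, hadj⟩ := (strongConflict_mk_iff haw).mp hc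
  rcases Sym2.mem_iff.mp hz with rfl | rfl
  · rcases hadj with hadj | hadj
    · exact absurd hadj (htf a b _ h.ab h.bc)
    · have := hcommon w haw hadj
      tauto
  · rcases hadj with hadj | hadj
    · have := hcommon _ hadj hcu.symm
      tauto
    · exact hadj

/-- The edges of the 4-cycle `a b c d`. -/
def cycleEdges [DecidableEq V] (a b c d : V) : Finset (Sym2 V) :=
  {s(a, b), s(b, c), s(c, d), s(d, a)}

theorem IsFourCycle.card_cycleEdges [DecidableEq V] {a b c d : V}
    (h : IsFourCycle G a b c d) : #(cycleEdges a b c d) = 4 := by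
  have := h.ab.ne
  have := h.bc.ne
  have := h.cd.ne
  have := h.da.ne
  have := h.ac
  have := h.bd
  rw [cycleEdges, card_eq_four]
  refine ⟨_, _, _, _, ?_, ?_, ?_, ?_, ?_, ?_, rfl⟩ <;> rw [Ne, Sym2.eq_iff] <;> grind

variable [Fintype V] [DecidableRel G.Adj] [DecidableEq V]

variable (G) in
/-- The edges of `G` with an endpoint among `a`, `b`, `c`, `d`. -/
def touchingEdges (a b c d : V) : Finset (Sym2 V) :=
  (G.incidenceFinset a ∪ G.incidenceFinset c) ∪ (G.incidenceFinset b ∪ G.incidenceFinset d)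

theorem mem_touchingEdges {a b c d : V} {e : Sym2 V} :
    e ∈ touchingEdges G a b c d ↔ e ∈ G.edgeSet ∧ (a ∈ e ∨ b ∈ e ∨ c ∈ e ∨ d ∈ e) := by
  simp only [touchingEdges, mem_union, mem_incidenceFinset_iff]
  tauto

theorem touchingEdges_rotate (a b c d : V) :
    touchingEdges G a b c d = touchingEdges G b c d a := by
  ext e
  simp only [mem_touchingEdges]
  tauto

theorem disjoint_incidenceFinset {a c : V} (hac : a ≠ c) (h : ¬ G.Adj a c) :
    Disjoint (G.incidenceFinset a) (G.incidenceFinset c) :=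
  disjoint_left.mpr fun f ha hc => by
    rw [mem_incidenceFinset_iff] at ha hc
    obtain rfl := (Sym2.mem_and_mem_iff hac).mp ⟨ha.2, hc.2⟩
    exact h ha.1

namespace IsFourCycle

variable {a b c d : V}

theorem cycleEdges_subset (h : IsFourCycle G a b c d) :
    cycleEdges a b c d ⊆ touchingEdges G a b c d := by
  intro e he
  rw [mem_touchingEdges]
  simp only [cycleEdges, mem_insert, mem_singleton] at he
  rcases he with rfl | rfl | rfl | rfl
  · exact ⟨h.ab, by simp⟩
  · exact ⟨h.bc, by simp⟩
  · exact ⟨h.cd, by simp⟩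
  · exact ⟨h.da, by simp⟩

theorem card_touchingEdges (hreg : ∀ v, G.degree v = 4)
    (htf : ∀ x y z, G.Adj x y → G.Adj y z → ¬ G.Adj x z) (h : IsFourCycle G a b c d) :
    #(touchingEdges G a b c d) = 12 := by
  have hinter : (G.incidenceFinset a ∪ G.incidenceFinset c) ∩
      (G.incidenceFinset b ∪ G.incidenceFinset d) = cycleEdges a b c d := by
    ext e
    constructor
    · intro he
      simp only [mem_inter, mem_union, mem_incidenceFinset_iff] at he
      simp only [cycleEdges, mem_insert, mem_singleton]
      obtain ⟨⟨-, h1⟩ | ⟨-, h1⟩, ⟨-, h2⟩ | ⟨-, h2⟩⟩ := he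
      · exact .inl ((Sym2.mem_and_mem_iff h.ab.ne).mp ⟨h1, h2⟩)
      · exact .inr (.inr (.inr ((Sym2.mem_and_mem_iff h.da.ne).mp ⟨h2, h1⟩)))
      · exact .inr (.inl ((Sym2.mem_and_mem_iff h.bc.ne).mp ⟨h2, h1⟩))
      · exact .inr (.inr (.inl ((Sym2.mem_and_mem_iff h.cd.ne).mp ⟨h1, h2⟩)))
    · intro he
      have he' := (mem_touchingEdges.mp (h.cycleEdges_subset he)).1
      simp only [cycleEdges, mem_insert, mem_singleton] at he
      simp only [mem_inter, mem_union, mem_incidenceFinset_iff]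
      rcases he with rfl | rfl | rfl | rfl <;> simp only [Sym2.mem_iff] <;> tauto
  have h1 := card_union_add_card_inter (G.incidenceFinset a ∪ G.incidenceFinset c)
    (G.incidenceFinset b ∪ G.incidenceFinset d)
  rw [hinter, h.card_cycleEdges,
    card_union_of_disjoint (disjoint_incidenceFinset h.ac (htf a b c h.ab h.bc)),
    card_union_of_disjoint (disjoint_incidenceFinset h.bd (htf b c d h.bc h.cd))] at h1
  simp only [card_incidenceFinset_of_regular hreg] at h1
  rw [touchingEdges]
  omega

theorem touchingEdges_subset_conflictEdges (h : IsFourCycle G a b c d) {e : Sym2 V}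
    (he : e ∈ cycleEdges a b c d) : touchingEdges G a b c d ⊆ conflictEdges G e := by
  have key : ∀ {a b c d : V}, IsFourCycle G a b c d →
      touchingEdges G a b c d ⊆ conflictEdges G s(a, b) := by
    intro a b c d h f hf
    rw [mem_touchingEdges] at hf
    refine mem_conflictEdges.mpr ⟨hf.1, (strongConflict_mk_iff h.ab).mpr ?_⟩
    rcases hf.2 with hf | hf | hf | hf
    · exact ⟨a, hf, .inr h.ab.symm⟩
    · exact ⟨b, hf, .inl h.ab⟩
    · exact ⟨c, hf, .inr h.bc⟩
    · exact ⟨d, hf, .inl h.da.symm⟩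
  have h1 := key h
  have h2 := key h.rotate
  have h3 := key h.rotate.rotate
  have h4 := key h.rotate.rotate.rotate
  rw [← touchingEdges_rotate] at h2 h3 h4
  rw [← touchingEdges_rotate] at h3 h4
  rw [← touchingEdges_rotate] at h4
  simp only [cycleEdges, mem_insert, mem_singleton] at he
  rcases he with rfl | rfl | rfl | rfl <;> assumption

theorem ten_le_card_inter (hreg : ∀ v, G.degree v = 4)
    (htf : ∀ x y z, G.Adj x y → G.Adj y z → ¬ G.Adj x z) (h : IsFourCycle G a b c d)
    {e : Sym2 V} (he : e ∈ touchingEdges G a b c d) :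
    10 ≤ #(conflictEdges G e ∩ touchingEdges G a b c d) := by
  have key : ∀ {a b c d : V}, IsFourCycle G a b c d → a ∈ e →
      10 ≤ #(conflictEdges G e ∩ touchingEdges G a b c d) := by
    intro a b c d h hae
    have hsub : G.incidenceFinset a ∪ (G.incidenceFinset b ∪ G.incidenceFinset d) ⊆
        conflictEdges G e ∩ touchingEdges G a b c d := by
      refine subset_inter (union_subset ?_ (union_subset ?_ ?_)) ?_
      · intro f hf
        rw [mem_incidenceFinset_iff] at hf
        exact mem_conflictEdges.mpr ⟨hf.1, .inl ⟨a, hae, hf.2⟩⟩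
      · exact incidenceFinset_subset_conflictEdges hae h.ab
      · exact incidenceFinset_subset_conflictEdges hae h.da.symm
      · exact union_subset_union_left subset_union_left
    have hinter : G.incidenceFinset a ∩ (G.incidenceFinset b ∪ G.incidenceFinset d) ⊆
        {s(a, b), s(a, d)} := by
      intro f hf
      simp only [mem_inter, mem_union, mem_incidenceFinset_iff] at hf
      simp only [mem_insert, mem_singleton]
      obtain ⟨⟨-, h1⟩, ⟨-, h2⟩ | ⟨-, h2⟩⟩ := hf
      · exact .inl ((Sym2.mem_and_mem_iff h.ab.ne).mp ⟨h1, h2⟩)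
      · exact .inr ((Sym2.mem_and_mem_iff h.da.ne.symm).mp ⟨h1, h2⟩)
    have h1 := card_le_card hsub
    have h2 := (card_le_card hinter).trans card_le_two
    have h3 := card_union_add_card_inter (G.incidenceFinset a)
      (G.incidenceFinset b ∪ G.incidenceFinset d)
    rw [card_union_of_disjoint (disjoint_incidenceFinset h.bd (htf b c d h.bc h.cd)),
      card_incidenceFinset_of_regular hreg, card_incidenceFinset_of_regular hreg,
      card_incidenceFinset_of_regular hreg] at h3
    omega
  rcases (mem_touchingEdges.mp he).2 with h1 | h1 | h1 | h1
  · exact key h h1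
  · rw [touchingEdges_rotate]
    exact key h.rotate h1
  · rw [touchingEdges_rotate, touchingEdges_rotate]
    exact key h.rotate.rotate h1
  · rw [touchingEdges_rotate, touchingEdges_rotate, touchingEdges_rotate]
    exact key h.rotate.rotate.rotate h1

end IsFourCycle

/-- Every common neighbor of `a` and `c` other than `b` saves a conflict of `ab`. -/
theorem card_conflictEdges_add_card_commonNeighbors_le (hreg : ∀ v, G.degree v = 4) {a c : V}
    (hac : a ≠ c) (S : Finset V) (hS : ∀ x ∈ S, G.Adj a x ∧ G.Adj x c) {b : V} (hb : b ∈ S) :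
    #(conflictEdges G s(a, b)) + #S ≤ 26 := by
  have h := card_conflictEdges_add_card_le hreg (hS b hb).1 ((S.erase b).image fun x => s(x, c))
    fun f hf => by
      obtain ⟨x, hx, rfl⟩ := mem_image.mp hf
      obtain ⟨hxb, hx⟩ := mem_erase.mp hx
      refine ⟨?_, ?_, x, c, rfl, (hS x hx).2, (hS x hx).1, (hS b hb).2⟩
      · rw [Sym2.mem_iff, not_or]
        exact ⟨(hS x hx).1.ne, hac⟩
      · rw [Sym2.mem_iff, not_or]
        exact ⟨Ne.symm hxb, (hS b hb).2.ne⟩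
  rw [card_image_of_injective _ fun x y hxy => Sym2.congr_left.mp hxy, card_erase_of_mem hb] at h
  have := card_pos.mpr ⟨b, hb⟩
  omega

namespace IsFourCycle

variable {a b c d : V}

theorem card_conflictEdges_le (hreg : ∀ v, G.degree v = 4) (h : IsFourCycle G a b c d)
    {e : Sym2 V} (he : e ∈ cycleEdges a b c d) : #(conflictEdges G e) ≤ 24 := by
  have key : ∀ {a b c d : V}, IsFourCycle G a b c d → #(conflictEdges G s(a, b)) ≤ 24 := by
    intro a b c d h
    have := card_conflictEdges_add_card_commonNeighbors_le hreg h.ac {b, d}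
      (by simp [h.ab, h.bc, h.da.symm, h.cd.symm]) (b := b) (by simp)
    rw [card_pair h.bd] at this
    omega
  simp only [cycleEdges, mem_insert, mem_singleton] at he
  rcases he with rfl | rfl | rfl | rfl
  · exact key h
  · exact key h.rotate
  · exact key h.rotate.rotate
  · exact key h.rotate.rotate.rotate

theorem card_conflictEdges_le_of_common (hreg : ∀ v, G.degree v = 4) (h : IsFourCycle G a b c d)
    {w : V} (haw : G.Adj a w) (hwc : G.Adj w c) (hwb : w ≠ b) (hwd : w ≠ d)
    {e : Sym2 V} (he : e ∈ cycleEdges a b c d) : #(conflictEdges G e) ≤ 23 := by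
  have hcard : #({b, d, w} : Finset V) = 3 :=
    card_eq_three.mpr ⟨b, d, w, h.bd, hwb.symm, hwd.symm, rfl⟩
  have h1 := fun x => card_conflictEdges_add_card_commonNeighbors_le hreg h.ac {b, d, w}
      (by simp [h.ab, h.bc, h.da.symm, h.cd.symm, haw, hwc]) (b := x)
  have h2 := fun x => card_conflictEdges_add_card_commonNeighbors_le hreg h.ac.symm {b, d, w}
      (by simp [h.ab.symm, h.bc.symm, h.da, h.cd, haw.symm, hwc.symm]) (b := x)
  rw [hcard] at h1 h2
  have h3 := h1 b (by simp)
  have h4 := h1 d (by simp)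
  have h5 := h2 b (by simp)
  have h6 := h2 d (by simp)
  simp only [cycleEdges, mem_insert, mem_singleton] at he
  rcases he with rfl | rfl | rfl | rfl
  · omega
  · rw [Sym2.eq_swap]; omega
  · omega
  · rw [Sym2.eq_swap]; omega

/-- The component of a 4-cycle can be colored if the edges touching the 4-cycle are not in pairwise
conflict, provided there is a second conflict-free pair or a third common neighbor of `a`, `c`. -/
theorem componentColorable_of_not_conflict (hreg : ∀ v, G.degree v = 4)
    (htf : ∀ x y z, G.Adj x y → G.Adj y z → ¬ G.Adj x z) (h : IsFourCycle G a b c d)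
    {p q : Sym2 V} (hp : p ∈ touchingEdges G a b c d) (hq : q ∈ touchingEdges G a b c d)
    (hpq : p ≠ q) (hnc : ¬ StrongConflict G p q)
    (h' : (∃ p' ∈ ((touchingEdges G a b c d).erase p).erase q,
        ∃ q' ∈ ((touchingEdges G a b c d).erase p).erase q, p' ≠ q' ∧ ¬ StrongConflict G p' q') ∨
      ∃ w, G.Adj a w ∧ G.Adj w c ∧ w ≠ b ∧ w ≠ d) :
    ComponentColorable G a := by
  classical
  refine componentColorable_of_listColoring hreg a (touchingEdges G a b c d)
    (fun e he => by rw [mem_incidenceFinset_iff] at he; rw [mem_touchingEdges]; tauto)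
    fun L hlast hL => ?_
  have hcyc : ∀ e ∈ cycleEdges a b c d, 34 ≤ #(L e) + #(conflictEdges G e) := fun e he => by
    have := hL e (h.cycleEdges_subset he)
    rwa [inter_eq_right.mpr (h.touchingEdges_subset_conflictEdges he),
      h.card_touchingEdges hreg htf] at this
  refine exists_isListColoring_of_not_conflict (fun _ _ => StrongConflict.symm)
    (h.card_touchingEdges hreg htf) h.cycleEdges_subset h.card_cycleEdges hlast ?_ ?_ ?_
    hp hq hpq hnc ?_
  · intro e he
    have h1 := hL e he
    have h2 := h.ten_le_card_inter hreg htf he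
    have h3 := _root_.card_conflictEdges_le hreg (mem_touchingEdges.mp he).1
    omega
  · intro e he
    have h1 := hcyc e he
    have h2 := h.card_conflictEdges_le hreg he
    omega
  · intro e he f hf
    exact (mem_conflictEdges.mp (h.touchingEdges_subset_conflictEdges he hf)).2
  · rcases h' with ⟨p', hp', q', hq', h'⟩ | ⟨w, haw, hwc, hwb, hwd⟩
    · refine .inl ⟨p', ?_, q', ?_, h'⟩
      · convert hp'
      · convert hq'
    · have he : s(a, b) ∈ cycleEdges a b c d := by simp [cycleEdges]
      have h1 := hcyc _ he
      have h2 := h.card_conflictEdges_le_of_common hreg haw hwc hwb hwd he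
      exact .inr ⟨_, he, by omega⟩

/-- The component of a 4-cycle in a `K₂,₃` can be colored if the edges touching the 4-cycle are in
pairwise conflict and the 4-cycle edge `ab` has at most 21 other conflicts. -/
theorem componentColorable_of_conflict (hreg : ∀ v, G.degree v = 4)
    (htf : ∀ x y z, G.Adj x y → G.Adj y z → ¬ G.Adj x z) (h : IsFourCycle G a b c d)
    {w : V} (haw : G.Adj a w) (hwc : G.Adj w c) (hwb : w ≠ b) (hwd : w ≠ d)
    (hall : ∀ p ∈ touchingEdges G a b c d, ∀ q ∈ touchingEdges G a b c d, StrongConflict G p q)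
    (hab : #(conflictEdges G s(a, b)) ≤ 22) :
    ComponentColorable G a := by
  refine componentColorable_of_listColoring hreg a (touchingEdges G a b c d)
    (fun e he => by rw [mem_incidenceFinset_iff] at he; rw [mem_touchingEdges]; tauto)
    fun L hlast hL => ?_
  have hL' : ∀ e ∈ touchingEdges G a b c d, 34 ≤ #(L e) + #(conflictEdges G e) := fun e he => by
    have := hL e he
    rwa [inter_eq_right.mpr fun f hf =>
        mem_conflictEdges.mpr ⟨(mem_touchingEdges.mp hf).1, hall e he f hf⟩,
      h.card_touchingEdges hreg htf] at this
  have he : s(a, b) ∈ cycleEdges a b c d := by simp [cycleEdges]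
  refine exists_isListColoring_of_card_le (h.card_touchingEdges hreg htf) h.cycleEdges_subset
    h.card_cycleEdges ?_ ?_ he ?_
  · intro e he
    have h1 := hL' e he
    have h2 := _root_.card_conflictEdges_le hreg (mem_touchingEdges.mp he).1
    omega
  · intro e he
    have h1 := hL' e (h.cycleEdges_subset he)
    have h2 := h.card_conflictEdges_le_of_common hreg haw hwc hwb hwd he
    omega
  · have h1 := hL' _ (h.cycleEdges_subset he)
    omega

end IsFourCycle

theorem exists_two_neighbors (hreg : ∀ v, G.degree v = 4) (a b d : V) :
    ∃ w w', w ≠ w' ∧ (G.Adj a w ∧ w ≠ b ∧ w ≠ d) ∧ (G.Adj a w' ∧ w' ≠ b ∧ w' ≠ d) := by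
  have h1 : #(G.neighborFinset a) - #({b, d} : Finset V) ≤ #(G.neighborFinset a \ {b, d}) :=
    le_card_sdiff _ _
  have h2 : #({b, d} : Finset V) ≤ 2 := card_le_two
  rw [G.card_neighborFinset_eq_degree, hreg] at h1
  obtain ⟨w, hw, w', hw', hne⟩ := one_lt_card.mp
    (show 1 < #(G.neighborFinset a \ {b, d}) by omega)
  simp only [mem_sdiff, SimpleGraph.mem_neighborFinset, mem_insert, mem_singleton, not_or]
    at hw hw'
  exact ⟨w, w', hne, hw, hw'⟩

/-- If `a` and `c` have no third common neighbor, then either two edges at `a` and `c` do not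
conflict or the outer endpoints of the edges hanging from `a` and `c` form a 4-cycle. -/
theorem IsFourCycle.exists_not_conflict_or (hreg : ∀ v, G.degree v = 4)
    (htf : ∀ x y z, G.Adj x y → G.Adj y z → ¬ G.Adj x z) {a b c d : V}
    (h : IsFourCycle G a b c d) (hcommon : ∀ w, G.Adj a w → G.Adj w c → w = b ∨ w = d) :
    (∃ w u, G.Adj a w ∧ G.Adj c u ∧ (w ≠ b ∧ w ≠ d) ∧ (u ≠ b ∧ u ≠ d) ∧
        ¬ StrongConflict G s(a, w) s(c, u)) ∨
      ∃ w w' u u', w ≠ w' ∧ u ≠ u' ∧ (G.Adj a w ∧ w ≠ b ∧ w ≠ d) ∧ (G.Adj a w' ∧ w' ≠ b ∧ w' ≠ d) ∧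
        (G.Adj c u ∧ u ≠ b ∧ u ≠ d) ∧ (G.Adj c u' ∧ u' ≠ b ∧ u' ≠ d) ∧
        G.Adj w u ∧ G.Adj w u' ∧ G.Adj w' u ∧ G.Adj w' u' := by
  by_contra! hcon
  obtain ⟨hcon, hcon'⟩ := hcon
  obtain ⟨w, w', hww, hw, hw'⟩ := exists_two_neighbors hreg a b d
  obtain ⟨u, u', huu, hu, hu'⟩ := exists_two_neighbors hreg c b d
  have key : ∀ x y, (G.Adj a x ∧ x ≠ b ∧ x ≠ d) → (G.Adj c y ∧ y ≠ b ∧ y ≠ d) → G.Adj x y :=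
    fun x y hx hy => h.adj_of_conflict htf hcommon hx.1 hx.2 hy.1 hy.2
      (hcon x y hx.1 hy.1 hx.2 hy.2)
  exact hcon' w w' u u' hww huu hw hw' hu hu' (key _ _ hw hu) (key _ _ hw hu') (key _ _ hw' hu)
    (key _ _ hw' hu')

/-- The component of a 4-cycle can be colored if it contains no `K₂,₃`. -/
theorem IsFourCycle.componentColorable_of_no_K23 (hreg : ∀ v, G.degree v = 4)
    (htf : ∀ x y z, G.Adj x y → G.Adj y z → ¬ G.Adj x z) {a b c d : V}
    (h : IsFourCycle G a b c d)
    (hno : ∀ x y z t, G.Reachable a x → IsFourCycle G x y z t →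
      ∀ w, G.Adj x w → G.Adj w z → w = y ∨ w = t) :
    ComponentColorable G a := by
  have key : ∀ {a' b' c' d'}, G.Reachable a a' → IsFourCycle G a' b' c' d' →
      ∃ w u, G.Adj a' w ∧ G.Adj c' u ∧ (w ≠ b' ∧ w ≠ d') ∧ (u ≠ b' ∧ u ≠ d') ∧
        ¬ StrongConflict G s(a', w) s(c', u) := by
    intro a' b' c' d' hr h
    rcases h.exists_not_conflict_or hreg htf (hno a' b' c' d' hr h) with h1 |
      ⟨w, w', u, u', hww, huu, hw, hw', hu, hu', h1, h2, h3, h4⟩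
    · exact h1
    · have hau : a' ≠ u := by
        rintro rfl
        exact htf _ b' _ h.ab h.bc hu.1.symm
      have hau' : a' ≠ u' := by
        rintro rfl
        exact htf _ b' _ h.ab h.bc hu'.1.symm
      have := hno w a' w' u (hr.trans hw.1.reachable) ⟨hw.1.symm, hw'.1, h3, h1.symm, hww, hau⟩
        u' h2 h4.symm
      rcases this with h | h
      · exact absurd h.symm hau'
      · exact absurd h.symm huu
  obtain ⟨w, u, haw, hcu, hw, hu, hnc⟩ := key .rfl h
  obtain ⟨x, y, hbx, hdy, hx, hy, hnc'⟩ := key h.ab.reachable h.rotate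
  have hne : ∀ {a w c u : V}, a ≠ c → a ≠ u → s(a, w) ≠ s(c, u) := by
    intro a w c u h1 h2 h3
    rcases Sym2.eq_iff.mp h3 with h3 | h3
    · exact h1 h3.1
    · exact h2 h3.1
  have hE : ∀ {z t}, z ∈ ({a, b, c, d} : Finset V) → G.Adj z t →
      s(z, t) ∈ touchingEdges G a b c d := fun hz hzt =>
    mem_touchingEdges.mpr ⟨hzt, by simp only [mem_insert, mem_singleton] at hz; grind⟩
  refine h.componentColorable_of_not_conflict hreg htf (hE (by simp) haw) (hE (by simp) hcu)
    (hne h.ac ?_) hnc (.inl ⟨s(b, x), ?_, s(d, y), ?_, hne h.bd ?_, hnc'⟩)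
  · rintro rfl
    exact htf _ b _ h.ab h.bc hcu.symm
  · rw [mem_erase, mem_erase]
    exact ⟨hne h.bc.ne hu.1.symm, hne h.ab.ne.symm hw.1.symm, hE (by simp) hbx⟩
  · rw [mem_erase, mem_erase]
    exact ⟨hne h.cd.ne.symm hu.2.symm, hne h.da.ne hw.2.symm, hE (by simp) hdy⟩
  · rintro rfl
    exact htf _ c _ h.bc h.cd hdy.symm

namespace IsFourCycle

variable {a b c d w : V}

theorem conflict_of_not_componentColorable (hreg : ∀ v, G.degree v = 4)
    (htf : ∀ x y z, G.Adj x y → G.Adj y z → ¬ G.Adj x z) (h : IsFourCycle G a b c d)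
    (haw : G.Adj a w) (hwc : G.Adj w c) (hwb : w ≠ b) (hwd : w ≠ d)
    (hnot : ¬ ComponentColorable G a) :
    ∀ p ∈ touchingEdges G a b c d, ∀ q ∈ touchingEdges G a b c d, StrongConflict G p q := by
  intro p hp q hq
  by_contra hc
  refine hnot (h.componentColorable_of_not_conflict hreg htf hp hq ?_ hc
    (.inr ⟨w, haw, hwc, hwb, hwd⟩))
  rintro rfl
  obtain ⟨x, y⟩ := p
  exact hc (.inl ⟨x, by simp⟩)

/-- If the component of a `K₂,₃` cannot be colored, the three vertices `b`, `d`, `w` are the only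
common neighbors of `a` and `c`. -/
theorem common_of_not_componentColorable (hreg : ∀ v, G.degree v = 4)
    (htf : ∀ x y z, G.Adj x y → G.Adj y z → ¬ G.Adj x z) (h : IsFourCycle G a b c d)
    (haw : G.Adj a w) (hwc : G.Adj w c) (hwb : w ≠ b) (hwd : w ≠ d)
    (hnot : ¬ ComponentColorable G a) {t : V} (hat : G.Adj a t) (htc : G.Adj t c) :
    t = b ∨ t = d ∨ t = w := by
  by_contra! ht
  refine hnot (h.componentColorable_of_conflict hreg htf haw hwc hwb hwd
    (h.conflict_of_not_componentColorable hreg htf haw hwc hwb hwd hnot) ?_)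
  have hcard : #({b, d, w, t} : Finset V) = 4 := card_eq_four.mpr
    ⟨b, d, w, t, h.bd, hwb.symm, ht.1.symm, hwd.symm, ht.2.1.symm, ht.2.2.symm, rfl⟩
  have := card_conflictEdges_add_card_commonNeighbors_le hreg h.ac {b, d, w, t}
    (by simp [h.ab, h.bc, h.da.symm, h.cd.symm, haw, hwc, hat, htc]) (b := b) (by simp)
  omega

/-- If the component of a `K₂,₃` with parts `a`, `c` and `b`, `d`, `w` cannot be colored, the
vertices `a` and `c` are the only common neighbors of `b` and `d`. -/
theorem common_opposite_of_not_componentColorable (hreg : ∀ v, G.degree v = 4)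
    (htf : ∀ x y z, G.Adj x y → G.Adj y z → ¬ G.Adj x z) (h : IsFourCycle G a b c d)
    (haw : G.Adj a w) (hwc : G.Adj w c) (hwb : w ≠ b) (hwd : w ≠ d)
    (hnot : ¬ ComponentColorable G a) {t : V} (hbt : G.Adj b t) (htd : G.Adj t d) :
    t = c ∨ t = a := by
  by_contra! ht
  refine hnot (h.componentColorable_of_conflict hreg htf haw hwc hwb hwd
    (h.conflict_of_not_componentColorable hreg htf haw hwc hwb hwd hnot) ?_)
  have hcard : #({s(d, c), s(w, c), s(d, t)} : Finset (Sym2 V)) = 3 := by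
    refine card_eq_three.mpr ⟨_, _, _, ?_, ?_, ?_, rfl⟩
    · exact fun e => hwd (Sym2.congr_left.mp e).symm
    · exact fun e => ht.1 (Sym2.congr_right.mp e).symm
    · intro e
      rcases Sym2.eq_iff.mp e with e | e
      · exact hwd e.1
      · exact h.cd.ne e.2
  have := card_conflictEdges_add_card_le hreg h.ab {s(d, c), s(w, c), s(d, t)} (by
    have h1 := h.ab.ne
    have h2 := h.bc.ne
    have h3 := h.da.ne
    have h4 := haw.ne
    have h5 := hbt.ne
    have h6 := h.ac
    have h7 := h.bd
    intro f hf
    simp only [mem_insert, mem_singleton] at hf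
    rcases hf with rfl | rfl | rfl <;> simp only [Sym2.mem_iff]
    · exact ⟨by grind, by grind, d, c, rfl, h.cd.symm, h.da.symm, h.bc⟩
    · exact ⟨by grind, by grind, w, c, rfl, hwc, haw, h.bc⟩
    · exact ⟨by grind, by grind, d, t, rfl, htd.symm, h.da.symm, hbt⟩)
  omega

theorem adj_of_not_componentColorable (hreg : ∀ v, G.degree v = 4)
    (htf : ∀ x y z, G.Adj x y → G.Adj y z → ¬ G.Adj x z) (h : IsFourCycle G a b c d)
    (haw : G.Adj a w) (hwc : G.Adj w c) (hwb : w ≠ b) (hwd : w ≠ d)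
    (hnot : ¬ ComponentColorable G a) {x x' y y' : V} (hxx : x ≠ x') (hyy : y ≠ y')
    (hbx : G.Adj b x) (hx : x ≠ c ∧ x ≠ a) (hbx' : G.Adj b x') (hx' : x' ≠ c ∧ x' ≠ a)
    (hdy : G.Adj d y) (hy : y ≠ c ∧ y ≠ a) (hdy' : G.Adj d y')
    (hxy : G.Adj x y) (hxy' : G.Adj x y') (hx'y : G.Adj x' y) (hx'y' : G.Adj x' y') :
    G.Adj y w := by
  have hby : ¬ G.Adj y b := fun hby => by
    have := h.common_opposite_of_not_componentColorable hreg htf haw hwc hwb hwd hnot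
      hby.symm hdy.symm
    tauto
  have hbd : ¬ G.Adj b d := htf b c d h.bc h.cd
  have hby' : b ≠ y := by
    rintro rfl
    exact hbd hdy.symm
  have hyb' : y' ≠ b := by
    rintro rfl
    exact hbd hdy'.symm
  have h' : IsFourCycle G x b x' y := ⟨hbx.symm, hbx', hx'y, hxy.symm, hxx, hby'⟩
  have hnot' : ¬ ComponentColorable G x := fun hcol =>
    hnot (hcol.of_reachable (h.ab.reachable.trans hbx.reachable).symm)
  have hcommon := fun t => h'.common_opposite_of_not_componentColorable hreg htf hxy' hx'y'.symm
    hyb' hyy.symm hnot' (t := t)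
  have hconf := h'.conflict_of_not_componentColorable hreg htf hxy' hx'y'.symm hyb' hyy.symm hnot'
  obtain ⟨t, hyt, ht, htd⟩ : ∃ t, G.Adj y t ∧ (t ≠ x' ∧ t ≠ x) ∧ t ≠ d := by
    obtain ⟨t, t', htt, ht, ht'⟩ := exists_two_neighbors hreg y x' x
    by_cases htd : t = d
    · exact ⟨t', ht'.1, ht'.2, fun h => htt (htd.trans h.symm)⟩
    · exact ⟨t, ht.1, ht.2, htd⟩
  have hadj : ∀ z, G.Adj b z → z ≠ x' ∧ z ≠ x → G.Adj z t := fun z hbz hz =>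
    h'.rotate.adj_of_conflict htf hcommon hbz hz hyt ht
      (hconf _ (mem_touchingEdges.mpr ⟨hbz, by simp⟩) _ (mem_touchingEdges.mpr ⟨hyt, by simp⟩))
  have hat := hadj a h.ab.symm ⟨hx'.2.symm, hx.2.symm⟩
  have hct := hadj c h.bc ⟨hx'.1.symm, hx.1.symm⟩
  rcases h.common_of_not_componentColorable hreg htf haw hwc hwb hwd hnot hat hct.symm with
    rfl | rfl | rfl
  · exact absurd hyt hby
  · exact absurd rfl htd
  · exact hyt

theorem componentColorable_of_K23 (hreg : ∀ v, G.degree v = 4)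
    (htf : ∀ x y z, G.Adj x y → G.Adj y z → ¬ G.Adj x z) (h : IsFourCycle G a b c d)
    (haw : G.Adj a w) (hwc : G.Adj w c) (hwb : w ≠ b) (hwd : w ≠ d) :
    ComponentColorable G a := by
  by_contra hnot
  have hconf := h.conflict_of_not_componentColorable hreg htf haw hwc hwb hwd hnot
  rcases h.rotate.exists_not_conflict_or hreg htf
    (fun t => h.common_opposite_of_not_componentColorable hreg htf haw hwc hwb hwd hnot) with
    ⟨x, y, hbx, hdy, -, -, hnc⟩ |
      ⟨x, x', y, y', hxx, hyy, hx, hx', hy, hy', hxy, hxy', hx'y, hx'y'⟩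
  · exact hnc (hconf _ (mem_touchingEdges.mpr ⟨hbx, by simp⟩) _
      (mem_touchingEdges.mpr ⟨hdy, by simp⟩))
  · have h1 := h.adj_of_not_componentColorable hreg htf haw hwc hwb hwd hnot hxx hyy hx.1 hx.2
      hx'.1 hx'.2 hy.1 hy.2 hy'.1 hxy hxy' hx'y hx'y'
    have h' : IsFourCycle G a d c b :=
      ⟨h.da.symm, h.cd.symm, h.bc.symm, h.ab.symm, h.ac, h.bd.symm⟩
    have h2 := h'.adj_of_not_componentColorable hreg htf haw hwc hwd hwb hnot hyy hxx hy.1 hy.2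
      hy'.1 hy'.2 hx.1 hx.2 hx'.1 hxy.symm hx'y.symm hxy'.symm hx'y'.symm
    exact htf x y w hxy h1 h2

end IsFourCycle

theorem componentColorable_of_triangleFree (hreg : ∀ v, G.degree v = 4)
    (htf : ∀ x y z, G.Adj x y → G.Adj y z → ¬ G.Adj x z) (v : V) : ComponentColorable G v := by
  by_cases hK : ∃ a b c d w, G.Reachable v a ∧ IsFourCycle G a b c d ∧ G.Adj a w ∧ G.Adj w c ∧
      w ≠ b ∧ w ≠ d
  · obtain ⟨a, b, c, d, w, hr, h, haw, hwc, hwb, hwd⟩ := hK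
    exact (h.componentColorable_of_K23 hreg htf haw hwc hwb hwd).of_reachable hr.symm
  by_cases hC : ∃ a b c d, G.Reachable v a ∧ IsFourCycle G a b c d
  · obtain ⟨a, b, c, d, hr, h⟩ := hC
    refine (h.componentColorable_of_no_K23 hreg htf ?_).of_reachable hr.symm
    intro x y z t hax h w hxw hwz
    by_contra! hw
    exact hK ⟨x, y, z, t, w, hr.trans hax, h, hxw, hwz, hw⟩
  · refine componentColorable_of_no_four_cycle hreg htf v fun b d a c hr hbd hba hbc hda hdc => ?_
    by_contra hac
    exact hC ⟨b, a, d, c, hr, hba, hda.symm, hdc, hbc.symm, hbd, hac⟩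

end FourCycle

/-- Every 4-regular simple graph with girth exactly 4 (a 4-cycle exists but no
3-cycle) has a strong edge-coloring with at most 22 colors. -/
theorem strong_edge_coloring_4regular_girth_4 {V : Type*} [Fintype V]
    (G : SimpleGraph V) [DecidableRel G.Adj]
    (hreg : ∀ v, G.degree v = 4)
    (h4 : ∃ (v : V) (c : G.Walk v v), c.IsCycle ∧ c.length = 4)
    (h3 : ∀ (v : V) (c : G.Walk v v), c.IsCycle → c.length ≠ 3) :
    ∃ C : G.edgeSet → Fin 22, IsStrongEdgeColoring G C := by
  classical
  have htf : ∀ x y z, G.Adj x y → G.Adj y z → ¬ G.Adj x z := by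
    intro x y z hxy hyz hxz
    refine h3 x (.cons hxy (.cons hyz (.cons hxz.symm .nil))) ?_ rfl
    have h1 := hxy.ne
    have h2 := hyz.ne
    have h3 := hxz.ne
    simp [SimpleGraph.Walk.cons_isCycle_iff, h1, h2, h3, h1.symm, h3.symm]
  choose φ hφ using componentColorable_of_triangleFree hreg htf
  -- Vertices of one component share a representative `r`.
  set r : V → V := fun v => (G.connectedComponentMk v).out with hr
  have hreach : ∀ v, G.Reachable (r v) v := fun v =>
    SimpleGraph.ConnectedComponent.exact (Quot.out_eq _)
  have hreq : ∀ {u v}, G.Reachable u v → r u = r v := fun h => by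
    simp only [hr, SimpleGraph.ConnectedComponent.sound h]
  have hmem : ∀ e ∈ G.edgeSet, ∀ x ∈ e, ∀ y ∈ e, G.Reachable x y := by
    intro e he x hx y hy
    by_cases hxy : x = y
    · rw [hxy]
    · obtain rfl := (Sym2.mem_and_mem_iff hxy).mp ⟨hx, hy⟩
      exact SimpleGraph.Adj.reachable he
  refine ⟨fun e => φ (r (e : Sym2 V).out.1) e, fun e f hef hc => ?_⟩
  have hout : ∀ e : G.edgeSet, ∀ x ∈ (e : Sym2 V), G.Reachable (e : Sym2 V).out.1 x :=
    fun e x hx => hmem e e.2 _ (Sym2.out_fst_mem _) x hx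
  have hef' : G.Reachable (e : Sym2 V).out.1 (f : Sym2 V).out.1 := by
    rcases hc with ⟨x, hxe, hxf⟩ | ⟨x, y, hxe, hyf, hxy⟩
    · exact (hout e x hxe).trans (hout f x hxf).symm
    · exact ((hout e x hxe).trans hxy.reachable).trans (hout f y hyf).symm
  dsimp only
  rw [hreq hef']
  exact hφ _ e e.2 f f.2 (fun h => hef (Subtype.ext h))
    (fun x hx => (hreach _).trans (hef'.symm.trans (hout e x hx)))
    (fun x hx => (hreach _).trans (hout f x hx)) hc
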